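/- arXiv:1007.4977 — 2 statements merged into one kernel-verified Lean document; each statement's English description precedes it below -/
import Mathlib

section
/- Let R be a ring and let (F_i, u_{ji} : F_i → F_j) be a direct system of right R-modules indexed by a directed partially ordered set (I, ≤), such that each F_i is flat and Mittag-Leffler. Assume that for each increasing chain (i_n | n < ω) in I, the direct limit colim_{n<ω} F_{i_n} is flat and Mittag-Leffler. Then M = colim_{i∈I} F_i is flat and Mittag-Leffler. -/
/-! Tensor product of a right `R`-module with a left `R`-module over a
(possibly noncommutative) ring `R`, Mittag-Leffler modules, flat right modules. -/

universe u

open scoped TensorProduct DirectSum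

section NCTensor

variable (R : Type u) [Ring R] (M : Type u) [AddCommGroup M] [Module Rᵐᵒᵖ M]

/-- The subgroup of balancing relations in `M ⊗_ℤ Q`, where `M` is a right `R`-module
and `Q` is a left `R`-module. -/
noncomputable def balancedSub (Q : Type u) [AddCommGroup Q] [Module R Q] :
    AddSubgroup (TensorProduct ℤ M Q) :=
  AddSubgroup.closure
    {x | ∃ (m : M) (r : R) (q : Q),
      x = (MulOpposite.op r • m) ⊗ₜ[ℤ] q - m ⊗ₜ[ℤ] (r • q)}

/-- The tensor product `M ⊗_R Q` of a right `R`-module `M` and a left `R`-module `Q`. -/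
def NCTensor (Q : Type u) [AddCommGroup Q] [Module R Q] : Type u :=
  TensorProduct ℤ M Q ⧸ balancedSub R M Q

noncomputable instance (Q : Type u) [AddCommGroup Q] [Module R Q] : AddCommGroup (NCTensor R M Q) :=
  inferInstanceAs (AddCommGroup (TensorProduct ℤ M Q ⧸ balancedSub R M Q))

/-- The canonical projection onto the tensor product `M ⊗_R Q`. -/
noncomputable def NCTensor.mk (Q : Type u) [AddCommGroup Q] [Module R Q] :
    TensorProduct ℤ M Q →+ NCTensor R M Q :=
  QuotientAddGroup.mk' (balancedSub R M Q)

variable {R M} in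
/-- The map `M ⊗_R Q →+ M ⊗_R Q'` induced by a map of left `R`-modules `f : Q → Q'`. -/
noncomputable def NCTensor.map {Q Q' : Type u} [AddCommGroup Q] [Module R Q]
    [AddCommGroup Q'] [Module R Q'] (f : Q →ₗ[R] Q') :
    NCTensor R M Q →+ NCTensor R M Q' :=
  QuotientAddGroup.lift (balancedSub R M Q)
    ((NCTensor.mk R M Q').comp
      (LinearMap.lTensor M f.toAddMonoidHom.toIntLinearMap).toAddMonoidHom)
    (by
      set φ := (NCTensor.mk R M Q').comp
        (LinearMap.lTensor M f.toAddMonoidHom.toIntLinearMap).toAddMonoidHom with hφ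
      intro x hx
      have hle : balancedSub R M Q ≤ φ.ker := by
        rw [balancedSub]
        rw [AddSubgroup.closure_le]
        rintro _ ⟨m, r, q, rfl⟩
        have h1 : φ ((MulOpposite.op r • m) ⊗ₜ[ℤ] q - m ⊗ₜ[ℤ] (r • q)) =
            NCTensor.mk R M Q'
              ((MulOpposite.op r • m) ⊗ₜ[ℤ] (f q) - m ⊗ₜ[ℤ] (r • f q)) := by
          simp [hφ, LinearMap.lTensor_tmul, map_sub]
        simp only [SetLike.mem_coe, AddMonoidHom.mem_ker, h1]
        exact (QuotientAddGroup.eq_zero_iff _).2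
          (AddSubgroup.subset_closure ⟨m, r, f q, rfl⟩)
      exact hle hx)

variable {ι : Type u} (Q : ι → Type u) [∀ i, AddCommGroup (Q i)] [∀ i, Module R (Q i)]

/-- Auxiliary map for the Mittag-Leffler comparison map. -/
noncomputable def piCompareAux :
    TensorProduct ℤ M (∀ i, Q i) →+ ∀ i, NCTensor R M (Q i) where
  toFun x i := NCTensor.mk R M (Q i)
    (LinearMap.lTensor M (LinearMap.proj (R := ℤ) (φ := Q) i) x)
  map_zero' := by funext i; simp
  map_add' x y := by funext i; simp [map_add]

/-- The canonical comparison map `M ⊗_R (∏ i, Q i) →+ ∏ i, (M ⊗_R Q i)`. -/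
noncomputable def mlCompare : NCTensor R M (∀ i, Q i) →+ ∀ i, NCTensor R M (Q i) :=
  QuotientAddGroup.lift (balancedSub R M (∀ i, Q i)) (piCompareAux R M Q)
    (by
      intro x hx
      have hle : balancedSub R M (∀ i, Q i) ≤ (piCompareAux R M Q).ker := by
        rw [balancedSub, AddSubgroup.closure_le]
        rintro _ ⟨m, r, q, rfl⟩
        simp only [SetLike.mem_coe, AddMonoidHom.mem_ker]
        funext i
        have h1 : piCompareAux R M Q
            ((MulOpposite.op r • m) ⊗ₜ[ℤ] q - m ⊗ₜ[ℤ] (r • q)) i =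
            NCTensor.mk R M (Q i)
              ((MulOpposite.op r • m) ⊗ₜ[ℤ] (q i) - m ⊗ₜ[ℤ] (r • q i)) := by
          simp [piCompareAux, map_sub, LinearMap.lTensor_tmul]
        rw [Pi.zero_apply, h1]
        exact (QuotientAddGroup.eq_zero_iff _).2
          (AddSubgroup.subset_closure ⟨m, r, q i, rfl⟩)
      exact hle hx)

/-- A right `R`-module `M` is Mittag-Leffler if for every family `(Q i)` of left
`R`-modules the canonical map `M ⊗_R ∏ Q i → ∏ (M ⊗_R Q i)` is injective. -/
def IsMittagLeffler : Prop :=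
  ∀ (ι : Type u) (Q : ι → Type u) [∀ i, AddCommGroup (Q i)] [∀ i, Module R (Q i)],
    Function.Injective (mlCompare R M Q)

/-- A right `R`-module `M` is flat if tensoring with `M` preserves injectivity of maps
of left `R`-modules. -/
def IsRightFlat : Prop :=
  ∀ (Q Q' : Type u) [AddCommGroup Q] [AddCommGroup Q'] [Module R Q] [Module R Q']
    (f : Q →ₗ[R] Q'), Function.Injective f →
      Function.Injective (NCTensor.map (M := M) f)

end NCTensor

section TensorFunctoriality

variable {R : Type u} [Ring R] {M N P : Type u} [AddCommGroup M] [Module Rᵐᵒᵖ M]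
  [AddCommGroup N] [Module Rᵐᵒᵖ N] [AddCommGroup P] [Module Rᵐᵒᵖ P]
  {Q Q' : Type u} [AddCommGroup Q] [Module R Q] [AddCommGroup Q'] [Module R Q']
  {A : Type*} [AddCommGroup A]

/-- The right `R`-module structure on additive maps out of a left `R`-module. -/
noncomputable instance addHomRightModule : Module Rᵐᵒᵖ (Q →+ A) where
  smul r φ := φ.comp (DistribSMul.toAddMonoidHom Q r.unop)
  one_smul φ := by ext q; change φ ((1 : R) • q) = φ q; rw [one_smul]
  mul_smul r s φ := by
    ext q; change φ ((s.unop * r.unop) • q) = φ (s.unop • r.unop • q); rw [mul_smul]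
  smul_zero r := rfl
  smul_add r φ ψ := rfl
  add_smul r s φ := by
    ext q; change φ ((r.unop + s.unop) • q) = φ (r.unop • q) + φ (s.unop • q)
    rw [add_smul, map_add]
  zero_smul φ := by ext q; change φ ((0 : R) • q) = 0; rw [zero_smul, map_zero]

namespace NCTensor

theorem mk_smul_tmul (m : M) (r : R) (q : Q) :
    mk R M Q ((MulOpposite.op r • m) ⊗ₜ[ℤ] q) = mk R M Q (m ⊗ₜ[ℤ] (r • q)) := by
  rw [← sub_eq_zero, ← map_sub]
  exact (QuotientAddGroup.eq_zero_iff _).2 (AddSubgroup.subset_closure ⟨m, r, q, rfl⟩)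

variable (R M Q) in
/-- The universal balanced map `M × Q → M ⊗_R Q`. -/
noncomputable def tmul : M →ₗ[Rᵐᵒᵖ] (Q →+ NCTensor R M Q) where
  toFun m := (mk R M Q).comp (TensorProduct.mk ℤ M Q m).toAddMonoidHom
  map_add' m m' := by
    ext q
    change mk R M Q ((m + m') ⊗ₜ[ℤ] q) = mk R M Q (m ⊗ₜ[ℤ] q) + mk R M Q (m' ⊗ₜ[ℤ] q)
    rw [TensorProduct.add_tmul, map_add]
  map_smul' r m := by
    ext q
    exact mk_smul_tmul m r.unop q

@[elab_as_elim]
theorem induction_on {p : NCTensor R M Q → Prop} (x : NCTensor R M Q) (zero : p 0)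
    (tmul : ∀ m q, p (tmul R M Q m q)) (add : ∀ x y, p x → p y → p (x + y)) : p x := by
  obtain ⟨y, rfl⟩ := QuotientAddGroup.mk'_surjective _ x
  change p (mk R M Q y)
  induction y using TensorProduct.induction_on with
  | zero => simpa using zero
  | tmul m q => exact tmul m q
  | add x y hx hy => rw [map_add]; exact add _ _ hx hy

theorem hom_ext {φ ψ : NCTensor R M Q →+ A}
    (h : ∀ m q, φ (tmul R M Q m q) = ψ (tmul R M Q m q)) : φ = ψ := by
  ext x
  induction x using induction_on with
  | zero => simp
  | tmul m q => exact h m q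
  | add x y hx hy => rw [map_add, map_add, hx, hy]

/-- The additive map out of `M ⊗_R Q` given by a balanced map. -/
noncomputable def lift (φ : M →ₗ[Rᵐᵒᵖ] (Q →+ A)) : NCTensor R M Q →+ A :=
  QuotientAddGroup.lift (balancedSub R M Q)
    (TensorProduct.liftAddHom φ.toAddMonoidHom fun n m q => by simp) (by
      rw [balancedSub, AddSubgroup.closure_le]
      rintro _ ⟨m, r, q, rfl⟩
      simp only [SetLike.mem_coe, AddMonoidHom.mem_ker, map_sub, TensorProduct.liftAddHom_tmul]
      change φ (MulOpposite.op r • m) q - φ m (r • q) = 0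
      rw [map_smul]
      exact sub_self _)

@[simp]
theorem lift_tmul (φ : M →ₗ[Rᵐᵒᵖ] (Q →+ A)) (m : M) (q : Q) :
    lift φ (tmul R M Q m q) = φ m q := rfl

variable (Q) in
/-- The map `M ⊗_R Q → N ⊗_R Q` induced by a map of right `R`-modules `M → N`. -/
noncomputable def rmap (f : M →ₗ[Rᵐᵒᵖ] N) : NCTensor R M Q →+ NCTensor R N Q :=
  lift (tmul R N Q ∘ₗ f)

@[simp]
theorem rmap_tmul (f : M →ₗ[Rᵐᵒᵖ] N) (m : M) (q : Q) :
    rmap Q f (tmul R M Q m q) = tmul R N Q (f m) q := rfl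

theorem rmap_rmap (g : N →ₗ[Rᵐᵒᵖ] P) (f : M →ₗ[Rᵐᵒᵖ] N) (x : NCTensor R M Q) :
    rmap Q g (rmap Q f x) = rmap Q (g ∘ₗ f) x :=
  DFunLike.congr_fun (hom_ext (φ := (rmap Q g).comp (rmap Q f))
    (ψ := rmap Q (g ∘ₗ f)) fun _ _ => by simp) x

@[simp]
theorem map_tmul (f : Q →ₗ[R] Q') (m : M) (q : Q) :
    map f (tmul R M Q m q) = tmul R M Q' m (f q) := rfl

theorem map_map {Q'' : Type u} [AddCommGroup Q''] [Module R Q''] (g : Q' →ₗ[R] Q'')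
    (f : Q →ₗ[R] Q') (x : NCTensor R M Q) : map g (map f x) = map (g ∘ₗ f) x :=
  DFunLike.congr_fun (hom_ext (φ := (map g).comp (map f))
    (ψ := map (g ∘ₗ f)) fun _ _ => by simp) x

theorem map_rmap (g : Q →ₗ[R] Q') (f : M →ₗ[Rᵐᵒᵖ] N) (x : NCTensor R M Q) :
    map g (rmap Q f x) = rmap Q' f (map g x) :=
  DFunLike.congr_fun (hom_ext (φ := (map g).comp (rmap Q f))
    (ψ := (rmap Q' f).comp (map g)) fun _ _ => by simp) x

@[simp]
theorem mlCompare_tmul {ι : Type u} (Q : ι → Type u) [∀ i, AddCommGroup (Q i)]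
    [∀ i, Module R (Q i)] (m : M) (q : ∀ i, Q i) (i : ι) :
    mlCompare R M Q (tmul R M (∀ i, Q i) m q) i = tmul R M (Q i) m (q i) := rfl

theorem mlCompare_apply {ι : Type u} (Q : ι → Type u) [∀ i, AddCommGroup (Q i)]
    [∀ i, Module R (Q i)] (x : NCTensor R M (∀ i, Q i)) (i : ι) :
    mlCompare R M Q x i = map (LinearMap.proj i) x :=
  DFunLike.congr_fun (hom_ext (φ := (Pi.evalAddMonoidHom _ i).comp (mlCompare R M Q))
    (ψ := map (LinearMap.proj i)) fun _ _ => by simp) x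

theorem subsingleton [Subsingleton M] : Subsingleton (NCTensor R M Q) := by
  refine subsingleton_of_forall_eq 0 fun x => ?_
  induction x using induction_on with
  | zero => rfl
  | tmul m q => rw [Subsingleton.elim m 0, map_zero, AddMonoidHom.zero_apply]
  | add x y hx hy => rw [hx, hy, add_zero]

end NCTensor

theorem IsMittagLeffler.eq_zero (hM : IsMittagLeffler R M) {ι : Type u} {Q : ι → Type u}
    [∀ i, AddCommGroup (Q i)] [∀ i, Module R (Q i)] {x : NCTensor R M (∀ i, Q i)}
    (hx : ∀ i, NCTensor.map (LinearMap.proj i : (∀ i, Q i) →ₗ[R] Q i) x = 0) : x = 0 := by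
  refine hM ι Q ?_
  rw [map_zero]
  funext i
  rw [NCTensor.mlCompare_apply, hx, Pi.zero_apply]

end TensorFunctoriality

section DirectLimit

variable {R : Type u} [Ring R] {I : Type*} [PartialOrder I]
  {F : I → Type u} [∀ i, AddCommGroup (F i)] [∀ i, Module Rᵐᵒᵖ (F i)]
  {f : ∀ i j, i ≤ j → F i →ₗ[Rᵐᵒᵖ] F j}

namespace NCTensor

theorem rmap_transition [DirectedSystem F fun i j h => f i j h]
    {Q : Type u} [AddCommGroup Q] [Module R Q] {i j k : I} (hij : i ≤ j) (hjk : j ≤ k)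
    (x : NCTensor R (F i) Q) :
    rmap Q (f j k hjk) (rmap Q (f i j hij) x) = rmap Q (f i k (hij.trans hjk)) x := by
  have : f j k hjk ∘ₗ f i j hij = f i k (hij.trans hjk) := by
    ext y
    exact DirectedSystem.map_map' f hij hjk y
  rw [rmap_rmap, this]

end NCTensor

open NCTensor

variable [DecidableEq I]

/-- An element of `F i ⊗ Q` that vanishes in `M ⊗ Q`, where `F i → M` lifts the canonical map to
the direct limit, vanishes at some stage `j ≥ i`. -/
theorem NCTensor.exists_rmap_eq_zero [IsDirected I (· ≤ ·)] [DirectedSystem F fun i j h => f i j h]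
    {M : Type u} [AddCommGroup M] [Module Rᵐᵒᵖ M] (θ : M →ₗ[Rᵐᵒᵖ] Module.DirectLimit F f)
    {i : I} {e : F i →ₗ[Rᵐᵒᵖ] M} (he : θ ∘ₗ e = Module.DirectLimit.of Rᵐᵒᵖ I F f i)
    {Q : Type u} [AddCommGroup Q] [Module R Q] {x : NCTensor R (F i) Q}
    (hx : rmap Q e x = 0) :
    ∃ j, ∃ h : i ≤ j, rmap Q (f i j h) x = 0 := by
  let g : ∀ i j, i ≤ j → NCTensor R (F i) Q →ₗ[ℤ] NCTensor R (F j) Q :=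
    fun i j h => (rmap Q (f i j h)).toIntLinearMap
  have : DirectedSystem (fun i => NCTensor R (F i) Q) fun i j h => g i j h :=
    { map_self := fun i x => by
        refine DFunLike.congr_fun (hom_ext (φ := rmap Q (f i i le_rfl))
          (ψ := AddMonoidHom.id _) fun m q => ?_) x
        rw [rmap_tmul, DirectedSystem.map_self' f, AddMonoidHom.id_apply]
      map_map := fun k j i hij hjk x => rmap_transition hij hjk x }
  let φ : Module.DirectLimit F f →ₗ[Rᵐᵒᵖ]
      (Q →+ Module.DirectLimit (fun i => NCTensor R (F i) Q) g) :=
    Module.DirectLimit.lift Rᵐᵒᵖ I F f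
      (fun i =>
        { toFun := fun m =>
            (Module.DirectLimit.of ℤ I _ g i).toAddMonoidHom.comp (tmul R (F i) Q m)
          map_add' := fun m m' => by ext q; simp
          map_smul' := fun r m => by rw [map_smul]; rfl })
      (fun i j h m => by
        ext q
        exact Module.DirectLimit.of_f (R := ℤ) (f := g) (hij := h) (x := tmul R (F i) Q m q))
  have key : lift (φ ∘ₗ θ) (rmap Q e x) = Module.DirectLimit.of ℤ I _ g i x := by
    refine DFunLike.congr_fun (hom_ext (φ := (lift (φ ∘ₗ θ)).comp (rmap Q e))
      (ψ := (Module.DirectLimit.of ℤ I _ g i).toAddMonoidHom) fun m q => ?_) x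
    change φ ((θ ∘ₗ e) m) q = _
    rw [he, Module.DirectLimit.lift_of]
    rfl
  rw [hx, map_zero] at key
  exact Module.DirectLimit.of.zero_exact key.symm

theorem of_comp {i j : I} (hij : i ≤ j) :
    Module.DirectLimit.of Rᵐᵒᵖ I F f j ∘ₗ f i j hij =
      Module.DirectLimit.of Rᵐᵒᵖ I F f i := by
  ext y
  exact Module.DirectLimit.of_f

section SameUniverse

variable {I : Type u} [PartialOrder I] [DecidableEq I] [IsDirected I (· ≤ ·)]
  {F : I → Type u} [∀ i, AddCommGroup (F i)] [∀ i, Module Rᵐᵒᵖ (F i)]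
  {f : ∀ i j, i ≤ j → F i →ₗ[Rᵐᵒᵖ] F j}

theorem NCTensor.exists_rmap_of [Nonempty I]
    {Q : Type u} [AddCommGroup Q] [Module R Q]
    (x : NCTensor R (Module.DirectLimit F f) Q) :
    ∃ i y, rmap Q (Module.DirectLimit.of Rᵐᵒᵖ I F f i) y = x := by
  induction x using induction_on with
  | zero => exact ⟨Classical.arbitrary I, 0, map_zero _⟩
  | tmul m q =>
    obtain ⟨i, y, rfl⟩ := Module.DirectLimit.exists_of m
    exact ⟨i, tmul R _ Q y q, rfl⟩
  | add x y hx hy =>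
    obtain ⟨i, a, rfl⟩ := hx
    obtain ⟨j, b, rfl⟩ := hy
    obtain ⟨k, hik, hjk⟩ := exists_ge_ge i j
    refine ⟨k, rmap Q (f i k hik) a + rmap Q (f j k hjk) b, ?_⟩
    rw [map_add, rmap_rmap, rmap_rmap]
    congr 3 <;> ext <;> simp

theorem IsRightFlat.directLimit [Nonempty I] [DirectedSystem F fun i j h => f i j h]
    (hF : ∀ i, IsRightFlat R (F i)) :
    IsRightFlat R (Module.DirectLimit F f) := by
  intro Q Q' _ _ _ _ g hg
  rw [injective_iff_map_eq_zero]
  intro x hx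
  obtain ⟨i, y, rfl⟩ := exists_rmap_of x
  rw [map_rmap] at hx
  obtain ⟨j, hij, hj⟩ := exists_rmap_eq_zero .id rfl hx
  rw [← map_rmap] at hj
  have h0 := (injective_iff_map_eq_zero _).1 (hF j Q Q' g hg) _ hj
  rw [← of_comp hij, ← rmap_rmap, h0, map_zero]

/-- If the direct limits along increasing chains are Mittag-Leffler, then an element of
`F i ⊗ ∏ Q k` all of whose components vanish in the limit has all its
components vanishing at a single stage. -/
theorem exists_forall_rmap_map_proj_eq_zero [DirectedSystem F fun i j h => f i j h]
    (hchain : ∀ g : ℕ →o I, IsMittagLeffler R (Module.DirectLimit (fun n => F (g n))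
      (fun n m h => f (g n) (g m) (g.monotone h))))
    {ι : Type u} {Q : ι → Type u} [∀ k, AddCommGroup (Q k)] [∀ k, Module R (Q k)] {i : I}
    {x : NCTensor R (F i) (∀ k, Q k)}
    (hx : ∀ k, rmap (Q k) (Module.DirectLimit.of Rᵐᵒᵖ I F f i)
      (map (LinearMap.proj k : (∀ k, Q k) →ₗ[R] Q k) x) = 0) :
    ∃ j, ∃ h : i ≤ j, ∀ k, rmap (Q k) (f i j h)
      (map (LinearMap.proj k : (∀ k, Q k) →ₗ[R] Q k) x) = 0 := by
  by_contra! hcon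
  have hcon' (j : {j // i ≤ j}) : ∃ k, rmap (Q k) (f i j j.2)
      (map (LinearMap.proj k : (∀ k, Q k) →ₗ[R] Q k) x) ≠ 0 := hcon j.1 j.2
  choose K hK using hcon'
  have hnext (j : {j // i ≤ j}) : ∃ j' : {j // i ≤ j}, j ≤ j' ∧ rmap (Q (K j)) (f i j' j'.2)
      (map (LinearMap.proj (K j) : (∀ k, Q k) →ₗ[R] Q (K j)) x) = 0 := by
    obtain ⟨l, hil, hl⟩ := exists_rmap_eq_zero .id rfl (hx (K j))
    obtain ⟨m, hjm, hlm⟩ := exists_ge_ge j.1 l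
    exact ⟨⟨m, hil.trans hlm⟩, hjm,
      (rmap_transition hil hlm _).symm.trans (by rw [hl, map_zero])⟩
  choose next hle hzero using hnext
  let s : ℕ → {j // i ≤ j} := fun n => n.rec ⟨i, le_rfl⟩ fun _ => next
  have hs : Monotone s := monotone_nat_of_le_succ fun n => hle (s n)
  let g : ℕ →o I := ⟨fun n => (s n).1, hs⟩
  have : DirectedSystem (fun n => F (g n)) fun n m h => f (g n) (g m) (g.monotone h) :=
    { map_self := fun n y => DirectedSystem.map_self' f y
      map_map := fun k m n hnm hmk y =>
        DirectedSystem.map_map' f (g.monotone hnm) (g.monotone hmk) y }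
  let p : (∀ k, Q k) →ₗ[R] (∀ n : ULift.{u} ℕ, Q (K (s n.down))) :=
    LinearMap.pi fun n => LinearMap.proj (K (s n.down))
  let e := Module.DirectLimit.of Rᵐᵒᵖ ℕ (fun n => F (g n))
    (fun n m h => f (g n) (g m) (g.monotone h))
  have he (n m : ℕ) (h : n ≤ m) : e m ∘ₗ f (g n) (g m) (g.monotone h) = e n :=
    of_comp (F := fun n => F (g n)) h
  have hlim : rmap _ (e 0) (map p x) = 0 := by
    refine (hchain g).eq_zero fun n => ?_
    rw [map_rmap, map_map]
    change rmap _ (e 0) (map (LinearMap.proj (K (s n.down))) x) = 0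
    rw [← he 0 (n.down + 1) (Nat.zero_le _), ← rmap_rmap]
    exact (congrArg _ (hzero (s n.down))).trans (map_zero _)
  obtain ⟨n, h0n, hn⟩ := exists_rmap_eq_zero .id rfl hlim
  refine hK (s n) ?_
  have := congrArg (map (LinearMap.proj (ULift.up n) :
    (∀ n : ULift.{u} ℕ, Q (K (s n.down))) →ₗ[R] Q (K (s n)))) hn
  rw [map_rmap, map_map] at this
  exact this.trans (map_zero _)

theorem isMittagLeffler_directLimit [Nonempty I] [DirectedSystem F fun i j h => f i j h]
    (hF : ∀ i, IsMittagLeffler R (F i))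
    (hchain : ∀ g : ℕ →o I, IsMittagLeffler R (Module.DirectLimit (fun n => F (g n))
      (fun n m h => f (g n) (g m) (g.monotone h)))) :
    IsMittagLeffler R (Module.DirectLimit F f) := by
  intro ι Q _ _
  rw [injective_iff_map_eq_zero]
  intro x hx
  obtain ⟨i, y, rfl⟩ := exists_rmap_of x
  obtain ⟨j, hij, hj⟩ := exists_forall_rmap_map_proj_eq_zero (f := f) hchain (x := y) fun k => by
    rw [← map_rmap, ← mlCompare_apply, hx, Pi.zero_apply]
  have h0 : rmap _ (f i j hij) y = 0 := (hF j).eq_zero fun k => by rw [map_rmap, hj]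
  rw [← of_comp hij, ← rmap_rmap, h0, map_zero]

end SameUniverse

end DirectLimit

/-- Let `(F i, f i j)` be a direct system of flat Mittag-Leffler right
`R`-modules indexed by a directed partially ordered set `I`. If for every increasing chain
`(i n)_{n<ω}` in `I` the direct limit `colimₙ F (i n)` is flat and Mittag-Leffler, then
`colim_{i ∈ I} F i` is flat and Mittag-Leffler. -/
theorem directLimit_flat_mittagLeffler
    (R : Type u) [Ring R] (I : Type u) [PartialOrder I] [IsDirected I (· ≤ ·)]
    [DecidableEq I] (F : I → Type u) [∀ i, AddCommGroup (F i)] [∀ i, Module Rᵐᵒᵖ (F i)]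
    (f : ∀ i j, i ≤ j → F i →ₗ[Rᵐᵒᵖ] F j) [DirectedSystem F fun i j h => f i j h]
    (hflat : ∀ i, IsRightFlat R (F i)) (hml : ∀ i, IsMittagLeffler R (F i))
    (hchain : ∀ g : ℕ →o I,
      IsRightFlat R (Module.DirectLimit (fun n => F (g n))
          (fun n m h => f (g n) (g m) (g.monotone h))) ∧
        IsMittagLeffler R (Module.DirectLimit (fun n => F (g n))
          (fun n m h => f (g n) (g m) (g.monotone h)))) :
    IsRightFlat R (Module.DirectLimit F f) ∧
      IsMittagLeffler R (Module.DirectLimit F f) := by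
  cases isEmpty_or_nonempty I
  · have hsub (Q : Type u) [AddCommGroup Q] [Module R Q] :
        Subsingleton (NCTensor R (Module.DirectLimit F f) Q) := NCTensor.subsingleton
    exact ⟨fun _ _ _ _ _ _ _ _ => Function.injective_of_subsingleton _,
      fun _ _ _ _ => Function.injective_of_subsingleton _⟩
  · exact ⟨.directLimit hflat, isMittagLeffler_directLimit hml fun g => (hchain g).2⟩
end

section
/- Let R be a countable ring and let C be a right R-module that is not cotorsion. Then there exists a flat right R-module F whose underlying set is countable such that Ext^1_R(F, C) ≠ 0. Equivalently, over a countable ring, a module C is cotorsion if and only if Ext^1_R(F, C) = 0 for every countable flat module F. -/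
/-! Tensor product of a right `R`-module with a left `R`-module over a
(possibly noncommutative) ring `R`, Mittag-Leffler modules, flat right modules. -/

universe u

open scoped TensorProduct DirectSum

section ExtGroup

open CategoryTheory

/-- The first Ext group `Ext¹_R(X, Y)` of two right `R`-modules, as a `ℤ`-module. -/
noncomputable def ext1 (R : Type u) [Ring R] (X Y : ModuleCat.{u} Rᵐᵒᵖ) : ModuleCat ℤ :=
  ((_root_.Ext ℤ (ModuleCat.{u} Rᵐᵒᵖ) 1).obj (Opposite.op X)).obj Y

end ExtGroup

section EquationalFlatness

open MulOpposite

theorem NCTensor.mk_smul_tmul_s16 {R M Q : Type u} [Ring R] [AddCommGroup M] [Module Rᵐᵒᵖ M]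
    [AddCommGroup Q] [Module R Q] (m : M) (r : R) (q : Q) :
    NCTensor.mk R M Q ((op r • m) ⊗ₜ[ℤ] q) = NCTensor.mk R M Q (m ⊗ₜ[ℤ] (r • q)) := by
  rw [← sub_eq_zero, ← map_sub]
  exact (QuotientAddGroup.eq_zero_iff _).2 (AddSubgroup.subset_closure ⟨m, r, q, rfl⟩)

theorem NCTensor.map_mk_tmul {R M Q Q' : Type u} [Ring R] [AddCommGroup M] [Module Rᵐᵒᵖ M]
    [AddCommGroup Q] [Module R Q] [AddCommGroup Q'] [Module R Q'] (f : Q →ₗ[R] Q')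
    (m : M) (q : Q) :
    NCTensor.map (M := M) f (NCTensor.mk R M Q (m ⊗ₜ[ℤ] q)) = NCTensor.mk R M Q' (m ⊗ₜ[ℤ] f q) :=
  rfl

section Relations

variable {R : Type u} [Ring R] {M : Type u} [AddCommGroup M] [Module Rᵐᵒᵖ M]

/-- The biadditive action `(m, k) ↦ m · k` of coefficient vectors with entries in `R` on
elements of a right `R`-module. -/
noncomputable def coeffSMul (ι : Type*) : M →+ (ι →₀ R) →+ (ι →₀ M) where
  toFun m := Finsupp.mapRange.addMonoidHom
    ((AddMonoidHom.flip (smulAddHom Rᵐᵒᵖ M) m).comp opAddEquiv.toAddMonoidHom)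
  map_zero' := by ext; simp
  map_add' m m' := by ext; simp

@[simp]
theorem coeffSMul_apply {ι : Type*} (m : M) (k : ι →₀ R) (i : ι) :
    coeffSMul ι m k i = op (k i) • m := rfl

variable {Q : Type u} [AddCommGroup Q] [Module R Q] {ι : Type*}

variable (M) in
/-- The subgroup of `ι →₀ M` generated by the vectors `m · k` with `k` a relation between the
elements `v i`. -/
noncomputable def relationSub (v : ι → Q) : AddSubgroup (ι →₀ M) :=
  AddSubgroup.closure
    {x | ∃ (m : M) (k : ι →₀ R), Finsupp.linearCombination R v k = 0 ∧ x = coeffSMul ι m k}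

theorem exists_sum_eq_of_mem_relationSub {v : ι → Q} {x : ι →₀ M}
    (hx : x ∈ relationSub (R := R) M v) :
    ∃ (n : ℕ) (m : Fin n → M) (k : Fin n → ι →₀ R),
      (∀ j, Finsupp.linearCombination R v (k j) = 0) ∧ x = ∑ j, coeffSMul ι (m j) (k j) := by
  induction hx using AddSubgroup.closure_induction with
  | mem x hx =>
    obtain ⟨m, k, hk, rfl⟩ := hx
    exact ⟨1, fun _ => m, fun _ => k, fun _ => hk, by simp⟩
  | zero => exact ⟨0, Fin.elim0, Fin.elim0, fun j => j.elim0, by simp⟩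
  | add x y _ _ hx hy =>
    obtain ⟨n, m, k, hk, rfl⟩ := hx
    obtain ⟨n', m', k', hk', rfl⟩ := hy
    refine ⟨n + n', Fin.append m m', Fin.append k k', fun j => ?_, ?_⟩
    · induction j using Fin.addCases with
      | left j => simpa using hk j
      | right j => simpa using hk' j
    · simp [Fin.sum_univ_add]
  | neg x _ hx =>
    obtain ⟨n, m, k, hk, rfl⟩ := hx
    exact ⟨n, fun j => -m j, k, hk, by simp⟩

theorem mem_relationSub_of_mk_eq_zero {v : ι → Q}
    (hv : Function.Surjective (Finsupp.linearCombination R v)) {ξ : ι →₀ M}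
    (hξ : NCTensor.mk R M Q (ξ.sum fun i m => m ⊗ₜ[ℤ] v i) = 0) :
    ξ ∈ relationSub (R := R) M v := by
  obtain ⟨s, hs⟩ := hv.hasRightInverse
  let p : (ι →₀ M) →+ (ι →₀ M) ⧸ relationSub (R := R) M v := QuotientAddGroup.mk' _
  have hp : ∀ (m : M) (k k' : ι →₀ R),
      Finsupp.linearCombination R v k = Finsupp.linearCombination R v k' →
        p (coeffSMul ι m k) = p (coeffSMul ι m k') := by
    intro m k k' h
    rw [← sub_eq_zero, ← map_sub, ← map_sub]
    exact (QuotientAddGroup.eq_zero_iff _).2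
      (AddSubgroup.subset_closure ⟨m, k - k', by simp [h], rfl⟩)
  let φ : M →+ Q →+ (ι →₀ M) ⧸ relationSub (R := R) M v :=
    { toFun := fun m =>
        { toFun := fun q => p (coeffSMul ι m (s q))
          map_zero' := by rw [hp m (s 0) 0 (by rw [hs]; simp)]; simp
          map_add' := fun q q' => by
            rw [hp m (s (q + q')) (s q + s q') (by simp only [map_add, hs _])]; simp }
      map_zero' := by ext; simp
      map_add' := fun m m' => by ext; simp }
  have hφ : ∀ m q, φ m q = p (coeffSMul ι m (s q)) := fun _ _ => rfl
  let Φ := TensorProduct.liftAddHom (R := ℤ) φ (fun n m q => by simp)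
  have hΦ : balancedSub R M Q ≤ Φ.ker := by
    rw [balancedSub, AddSubgroup.closure_le]
    rintro _ ⟨m, r, q, rfl⟩
    rw [SetLike.mem_coe, AddMonoidHom.mem_ker, map_sub, sub_eq_zero]
    simp only [Φ, TensorProduct.liftAddHom_tmul, hφ]
    rw [hp m (s (r • q)) (r • s q) (by simp only [map_smul, hs _])]
    congr 1
    ext i
    simp [mul_smul]
  have h0 : Φ (ξ.sum fun i m => m ⊗ₜ[ℤ] v i) = 0 := hΦ ((QuotientAddGroup.eq_zero_iff _).1 hξ)
  have h1 : Φ (ξ.sum fun i m => m ⊗ₜ[ℤ] v i) = p ξ := by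
    rw [Finsupp.sum, map_sum]
    conv_rhs => rw [← Finsupp.sum_single ξ, Finsupp.sum, map_sum]
    refine Finset.sum_congr rfl fun i _ => ?_
    simp only [Φ, TensorProduct.liftAddHom_tmul, hφ]
    rw [hp (ξ i) (s (v i)) (Finsupp.single i 1) (by rw [hs]; simp)]
    congr 1
    classical
    ext j
    by_cases h : i = j <;> simp [h]
  exact (QuotientAddGroup.eq_zero_iff _).1 (h1.symm.trans h0)

end Relations

/-- The equational criterion for flatness of a right `R`-module `M`: every linear relation
`∑ mᵢ rᵢ = 0` in `M` is trivial. -/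
def EquationallyFlat (R : Type*) [Ring R] (M : Type*) [AddCommGroup M] [Module Rᵐᵒᵖ M] : Prop :=
  ∀ (n : ℕ) (r : Fin n → R) (m : Fin n → M), ∑ i, op (r i) • m i = 0 →
    ∃ (k : ℕ) (a : Fin k → Fin n → R) (m' : Fin k → M),
      (∀ i, m i = ∑ j, op (a j i) • m' j) ∧ ∀ j, ∑ i, a j i * r i = 0

theorem IsRightFlat.equationallyFlat {R : Type u} [Ring R] {M : Type u} [AddCommGroup M]
    [Module Rᵐᵒᵖ M] (h : IsRightFlat R M) : EquationallyFlat R M := by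
  intro n r m hm
  let I : Submodule R R := Submodule.span R (Set.range r)
  let v : Fin n → I := fun i => ⟨r i, Submodule.subset_span ⟨i, rfl⟩⟩
  have hI : ∀ k, I.subtype (Finsupp.linearCombination R v k) =
      Finsupp.linearCombination R r k := fun k => by
    rw [Finsupp.apply_linearCombination]; rfl
  have hv : Function.Surjective (Finsupp.linearCombination R v) := fun ⟨x, hx⟩ => by
    rw [show I = _ from (Finsupp.range_linearCombination R).symm] at hx
    obtain ⟨k, rfl⟩ := hx
    exact ⟨k, Subtype.ext (hI k)⟩
  have hξ : NCTensor.mk R M I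
      ((Finsupp.equivFunOnFinite.symm m).sum fun i m => m ⊗ₜ[ℤ] v i) = 0 := by
    apply h I R I.subtype I.subtype_injective
    rw [Finsupp.sum_fintype _ _ (by simp), map_sum, map_sum, map_zero]
    have : ∀ i, NCTensor.map (M := M) I.subtype (NCTensor.mk R M I (m i ⊗ₜ[ℤ] v i)) =
        NCTensor.mk R M R ((op (r i) • m i) ⊗ₜ[ℤ] (1 : R)) := fun i => by
      rw [NCTensor.map_mk_tmul, NCTensor.mk_smul_tmul_s16]
      simp [v]
    simp only [Finsupp.equivFunOnFinite_symm_apply_apply, this]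
    rw [← map_sum, ← TensorProduct.sum_tmul, hm]
    simp
  obtain ⟨k, m', a, ha, hm'⟩ :=
    exists_sum_eq_of_mem_relationSub (mem_relationSub_of_mk_eq_zero hv hξ)
  refine ⟨k, fun j i => a j i, m', fun i => ?_, fun j => ?_⟩
  · simpa using DFunLike.congr_fun hm' i
  · have := hI (a j)
    rw [ha j, map_zero, Finsupp.linearCombination_apply, Finsupp.sum_fintype _ _ (by simp)] at this
    exact this.symm

theorem EquationallyFlat.exists_of_finset {R : Type*} [Ring R] {M : Type*} [AddCommGroup M]
    [Module Rᵐᵒᵖ M] (h : EquationallyFlat R M) {τ : Type*} (T : Finset τ) {n : ℕ}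
    (c : Fin n → τ → R) (m : Fin n → M) (hm : ∀ t ∈ T, ∑ j, op (c j t) • m j = 0) :
    ∃ (k : ℕ) (b : Fin k → Fin n → R) (m' : Fin k → M),
      (∀ j, m j = ∑ l, op (b l j) • m' l) ∧ ∀ l, ∀ t ∈ T, ∑ j, b l j * c j t = 0 := by
  classical
  induction T using Finset.induction_on with
  | empty =>
    refine ⟨n, fun l j => if l = j then 1 else 0, m, fun j => ?_, by simp⟩
    rw [Finset.sum_eq_single j] <;> simp +contextual
  | insert t T _ ih =>
    obtain ⟨k, b, m', hb, hbT⟩ := ih fun t ht => hm t (Finset.mem_insert_of_mem ht)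
    obtain ⟨k', d, m'', hd, hdt⟩ := h k (fun l => ∑ j, b l j * c j t) m' (by
      rw [← hm t (Finset.mem_insert_self _ _)]
      simp_rw [hb, Finset.smul_sum, Finset.op_sum, Finset.sum_smul, smul_smul]
      rw [Finset.sum_comm]
      rfl)
    have key : ∀ l t, ∑ j, (∑ i, d l i * b i j) * c j t = ∑ i, d l i * ∑ j, b i j * c j t := by
      intro l t
      simp_rw [Finset.sum_mul, Finset.mul_sum, mul_assoc]
      exact Finset.sum_comm
    refine ⟨k', fun l j => ∑ i, d l i * b i j, m'', fun j => ?_, fun l s hs => ?_⟩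
    · rw [hb]
      simp_rw [hd, Finset.smul_sum, Finset.op_sum, Finset.sum_smul, smul_smul]
      rw [Finset.sum_comm]
      rfl
    · rw [key]
      rcases Finset.mem_insert.1 hs with rfl | hs
      · exact hdt l
      · simp [hbT _ s hs]

theorem EquationallyFlat.isRightFlat {R : Type u} [Ring R] {M : Type u} [AddCommGroup M]
    [Module Rᵐᵒᵖ M] (h : EquationallyFlat R M) : IsRightFlat R M := by
  classical
  intro Q Q' _ _ _ _ f hf
  rw [injective_iff_map_eq_zero]
  intro x hx
  let β : (Q →₀ M) →+ NCTensor R M Q := (NCTensor.mk R M Q).comp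
    (Finsupp.liftAddHom fun q => ((TensorProduct.mk ℤ M Q).flip q).toAddMonoidHom)
  have hβ : ∀ q m, β (Finsupp.single q m) = NCTensor.mk R M Q (m ⊗ₜ[ℤ] q) := fun q m => by
    simp [β]
  obtain ⟨ξ, rfl⟩ : ∃ ξ, β ξ = x := by
    obtain ⟨y, rfl⟩ : ∃ y, NCTensor.mk R M Q y = x :=
      QuotientAddGroup.mk'_surjective (balancedSub R M Q) x
    clear hx
    induction y with
    | zero => exact ⟨0, by simp⟩
    | tmul m q => exact ⟨Finsupp.single q m, hβ q m⟩
    | add y z hy hz =>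
      obtain ⟨η, hη⟩ := hy
      obtain ⟨ζ, hζ⟩ := hz
      exact ⟨η + ζ, by rw [map_add, map_add, hη, hζ]⟩
  have hβ_smul : ∀ (m : M) (c : Q →₀ R),
      β (coeffSMul Q m c) = NCTensor.mk R M Q (m ⊗ₜ[ℤ] Finsupp.linearCombination R id c) := by
    intro m c
    induction c using Finsupp.induction_linear with
    | zero => simp
    | add c c' hc hc' => simp only [map_add, hc, hc', TensorProduct.tmul_add]
    | single q r =>
      have : coeffSMul Q m (Finsupp.single q r) = Finsupp.single q (op r • m) := by
        ext q'
        by_cases h : q = q' <;> simp [h]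
      rw [this, hβ, NCTensor.mk_smul_tmul_s16]
      simp
  have hmap : NCTensor.mk R M Q' ((Finsupp.mapDomain f ξ).sum fun q m => m ⊗ₜ[ℤ] id q) = 0 := by
    rw [← hx, Finsupp.sum_mapDomain_index (by simp) (by simp [TensorProduct.add_tmul])]
    simp [β, Finsupp.sum, map_sum, NCTensor.map_mk_tmul]
  obtain ⟨n, m, k, hk, hsum⟩ := exists_sum_eq_of_mem_relationSub
    (mem_relationSub_of_mk_eq_zero (R := R) (Finsupp.linearCombination_id_surjective R Q') hmap)
  replace hsum : ∀ t, Finsupp.mapDomain f ξ t = ∑ j, op (k j t) • m j := fun t => by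
    simp [hsum]
  obtain ⟨p, b, m', hm', hb⟩ := h.exists_of_finset
    ((Finset.univ.biUnion fun j => (k j).support).filter (· ∉ Set.range f)) (fun j t => k j t) m
    (fun t ht => by
      rw [← hsum, Finsupp.mapDomain_of_notMem_range _ _ (Finset.mem_filter.1 ht).2])
  let c : Fin p → Q' →₀ R := fun l => ∑ j, b l j • k j
  have hc : ∀ l t, c l t = ∑ j, b l j * k j t := fun l t => by simp [c]
  have hc_range : ∀ l, ↑(c l).support ⊆ Set.range f := by
    intro l t ht
    by_contra htf
    refine (Finsupp.mem_support_iff.1 ht) ?_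
    rw [hc]
    by_cases hT : t ∈ Finset.univ.biUnion fun j => (k j).support
    · exact hb l t (Finset.mem_filter.2 ⟨hT, htf⟩)
    · refine Finset.sum_eq_zero fun j _ => ?_
      have : k j t = 0 := by
        by_contra hkt
        exact hT (Finset.mem_biUnion.2 ⟨j, Finset.mem_univ _, Finsupp.mem_support_iff.2 hkt⟩)
      simp [this]
  let c' : Fin p → Q →₀ R := fun l => (c l).comapDomain f hf.injOn
  have hc' : ∀ l, Finsupp.linearCombination R id (c' l) = 0 := by
    intro l
    apply hf
    have h₁ : Finsupp.mapDomain f (c' l) = c l :=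
      Finsupp.mapDomain_comapDomain f hf (c l) (hc_range l)
    have h₂ : Finsupp.linearCombination R id (c l) = 0 := by simp [c, hk]
    rw [← h₁, Finsupp.linearCombination_mapDomain] at h₂
    rw [Finsupp.apply_linearCombination, map_zero]
    exact h₂
  have hξ : ξ = ∑ l, coeffSMul Q (m' l) (c' l) := by
    ext q
    rw [← Finsupp.mapDomain_apply hf ξ q, hsum]
    simp only [Finsupp.finsetSum_apply, coeffSMul_apply, c', Finsupp.comapDomain_apply, hc]
    simp_rw [hm', Finset.smul_sum, Finset.op_sum, Finset.sum_smul, smul_smul]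
    rw [Finset.sum_comm]
    rfl
  rw [hξ, map_sum]
  exact Finset.sum_eq_zero fun l _ => by rw [hβ_smul, hc']; simp

end EquationalFlatness

section CountablePure

open MulOpposite

theorem Submodule.countable_span {S M : Type*} [Ring S] [Countable S] [AddCommGroup M]
    [Module S M] {s : Set M} (hs : s.Countable) : Countable (Submodule.span S s) := by
  have := hs.to_subtype
  have h := (Finsupp.linearCombination S ((↑) : s → M)).surjective_rangeRestrict.countable
  rwa [Finsupp.range_linearCombination, Subtype.range_coe] at h

/-- Over a countable ring, every element lies in a countable submodule closed under a given
family of finitary operations, each producing countably many values. -/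
theorem exists_countable_submodule_closed {S M : Type*} [Ring S] [Countable S] [AddCommGroup M]
    [Module S M] (W : ∀ n : ℕ, (Fin n → M) → Set M) (hW : ∀ n m, (W n m).Countable) (x : M) :
    ∃ G : Submodule S M, x ∈ G ∧ Countable G ∧
      ∀ n (m : Fin n → M), (∀ i, m i ∈ G) → W n m ⊆ G := by
  let step : Submodule S M → Submodule S M := fun G =>
    Submodule.span S (G ∪ ⋃ (n : ℕ) (m : Fin n → G), W n fun i => m i)
  have hle : ∀ G, G ≤ step G := fun G y hy => Submodule.subset_span (Or.inl hy)
  let H : ℕ → Submodule S M := fun k => step^[k] (Submodule.span S {x})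
  have hH : ∀ k, H (k + 1) = step (H k) := fun k => Function.iterate_succ_apply' _ _ _
  have hmono : Monotone H := monotone_nat_of_le_succ fun k => (hH k).symm ▸ hle _
  have hcount : ∀ k, Countable (H k) := by
    intro k
    induction k with
    | zero => exact Submodule.countable_span (Set.countable_singleton x)
    | succ k ih =>
      rw [hH]
      refine Submodule.countable_span ((Set.to_countable (H k : Set M)).union ?_)
      exact Set.countable_iUnion fun n => Set.countable_iUnion fun m => hW n _
  have hmem : ∀ y, y ∈ ⨆ k, H k ↔ ∃ k, y ∈ H k := fun y =>
    Submodule.mem_iSup_of_directed _ hmono.directed_le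
  refine ⟨⨆ k, H k, (hmem x).2 ⟨0, Submodule.mem_span_singleton_self x⟩, ?_, ?_⟩
  · have : ((⨆ k, H k : Submodule S M) : Set M) = ⋃ k, (H k : Set M) := by
      ext y
      simp [hmem]
    exact Set.Countable.to_subtype (this ▸ Set.countable_iUnion fun k => Set.to_countable _)
  · intro n m hm y hy
    choose k hk using fun i => (hmem _).1 (hm i)
    let K := Finset.univ.sup k
    have hK : ∀ i, m i ∈ H K := fun i => hmono (Finset.le_sup (Finset.mem_univ i)) (hk i)
    refine (hmem y).2 ⟨K + 1, ?_⟩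
    rw [hH]
    exact Submodule.subset_span (Or.inr (Set.mem_iUnion₂.2 ⟨n, fun i => ⟨m i, hK i⟩, hy⟩))

theorem EquationallyFlat.exists_countable_pure {R : Type*} [Ring R] [Countable R] {M : Type*}
    [AddCommGroup M] [Module Rᵐᵒᵖ M] (h : EquationallyFlat R M) (x : M) :
    ∃ G : Submodule Rᵐᵒᵖ M, x ∈ G ∧ Countable G ∧ EquationallyFlat R G ∧
      ∀ (n : ℕ) (r : Fin n → R) (m : Fin n → M), ∑ i, op (r i) • m i ∈ G →
        ∃ g : Fin n → M, (∀ i, g i ∈ G) ∧ ∑ i, op (r i) • g i = ∑ i, op (r i) • m i := by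
  classical
  have : Countable Rᵐᵒᵖ := opEquiv.symm.injective.countable
  choose! k a w hw using h
  let sol : (n : ℕ) → (Fin n → R) → M → Fin n → M := fun n r y =>
    if hy : ∃ m : Fin n → M, ∑ i, op (r i) • m i = y then hy.choose else 0
  have hsol : ∀ n r (m : Fin n → M),
      ∑ i, op (r i) • sol n r (∑ i, op (r i) • m i) i = ∑ i, op (r i) • m i := by
    intro n r m
    have hy : ∃ m' : Fin n → M, ∑ i, op (r i) • m' i = ∑ i, op (r i) • m i := ⟨m, rfl⟩
    simp only [sol, dif_pos hy]
    exact hy.choose_spec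
  obtain ⟨G, hxG, hG, hcl⟩ := exists_countable_submodule_closed (S := Rᵐᵒᵖ)
    (fun n m => (⋃ r : Fin n → R, Set.range (w n r m)) ∪
      ⋃ (k : ℕ) (r : Fin k → R), Set.range (sol k r (∑ i, m i)))
    (fun n m => (Set.countable_iUnion fun r => Set.countable_range _).union
      (Set.countable_iUnion fun k => Set.countable_iUnion fun r => Set.countable_range _)) x
  refine ⟨G, hxG, hG, fun n r m hm => ?_, fun n r m hm => ?_⟩
  · have hm' : ∑ i, op (r i) • (m i : M) = 0 := by simpa using congrArg G.subtype hm
    obtain ⟨h₁, h₂⟩ := hw n r (fun i => m i) hm'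
    refine ⟨k n r fun i => m i, a n r fun i => m i, fun j => ⟨w n r (fun i => m i) j, ?_⟩,
      fun i => Subtype.ext (by simpa using h₁ i), h₂⟩
    exact hcl n (fun i => m i) (fun i => (m i).2)
      (Or.inl (Set.mem_iUnion.2 ⟨r, Set.mem_range_self j⟩))
  · refine ⟨sol n r (∑ i, op (r i) • m i), fun i => ?_, hsol n r m⟩
    refine hcl 1 (fun _ => ∑ i, op (r i) • m i) (fun _ => hm)
      (Or.inr (Set.mem_iUnion₂.2 ⟨n, r, i, ?_⟩))
    simp

end CountablePure

section Extension

open MulOpposite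

theorem equationallyFlat_quotient_iff {R P : Type*} [Ring R] [AddCommGroup P] [Module Rᵐᵒᵖ P]
    (N : Submodule Rᵐᵒᵖ P) :
    EquationallyFlat R (P ⧸ N) ↔
      ∀ (n : ℕ) (r : Fin n → R) (p : Fin n → P), ∑ i, op (r i) • p i ∈ N →
        ∃ (k : ℕ) (a : Fin k → Fin n → R) (p' : Fin k → P),
          (∀ i, p i - ∑ j, op (a j i) • p' j ∈ N) ∧ ∀ j, ∑ i, a j i * r i = 0 := by
  have hmk : ∀ n (r : Fin n → R) (p : Fin n → P),
      ∑ i, op (r i) • N.mkQ (p i) = N.mkQ (∑ i, op (r i) • p i) := by simp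
  constructor
  · intro h n r p hp
    obtain ⟨k, a, m, hm, ha⟩ := h n r (fun i => N.mkQ (p i)) (by
      rw [hmk]
      exact (Submodule.Quotient.mk_eq_zero N).2 hp)
    choose p' hp' using fun j => N.mkQ_surjective (m j)
    refine ⟨k, a, p', fun i => ?_, ha⟩
    rw [← Submodule.Quotient.mk_eq_zero N, ← Submodule.mkQ_apply, map_sub, ← hmk, hm, sub_eq_zero]
    simp only [hp']
  · intro h n r m hm
    choose p hp using fun i => N.mkQ_surjective (m i)
    obtain rfl : m = fun i => N.mkQ (p i) := funext fun i => (hp i).symm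
    rw [hmk] at hm
    obtain ⟨k, a, p', hp', ha⟩ := h n r p ((Submodule.Quotient.mk_eq_zero N).1 hm)
    refine ⟨k, a, fun j => N.mkQ (p' j), fun i => ?_, ha⟩
    rw [hmk, ← sub_eq_zero, ← map_sub]
    exact (Submodule.Quotient.mk_eq_zero N).2 (hp' i)

theorem exists_extension_of_equationallyFlat_quotient {R P C : Type u} [Ring R] [Countable R]
    [AddCommGroup P] [Module Rᵐᵒᵖ P] [AddCommGroup C] [Module Rᵐᵒᵖ C]
    (hC : ∀ (F : Type u) [AddCommGroup F] [Module Rᵐᵒᵖ F], Countable F → EquationallyFlat R F →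
      ∀ (B : Type u) [AddCommGroup B] [Module Rᵐᵒᵖ B] (π : B →ₗ[Rᵐᵒᵖ] F),
        Function.Surjective π → ∀ g : LinearMap.ker π →ₗ[Rᵐᵒᵖ] C,
          ∃ h : B →ₗ[Rᵐᵒᵖ] C, ∀ x : LinearMap.ker π, h x = g x)
    (K : Submodule Rᵐᵒᵖ P) (hK : EquationallyFlat R (P ⧸ K)) (f : K →ₗ[Rᵐᵒᵖ] C) :
    ∃ h : P →ₗ[Rᵐᵒᵖ] C, ∀ x : K, h x = f x := by
  let f₀ : P →ₗ.[Rᵐᵒᵖ] C := ⟨K, f⟩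
  obtain ⟨g, hf₀g, ⟨-, hgflat⟩, hmax⟩ := zorn_le_nonempty₀
    {g : P →ₗ.[Rᵐᵒᵖ] C | f₀ ≤ g ∧ EquationallyFlat R (P ⧸ g.domain)}
    (fun c hcs hc g₀ hg₀ => by
      have hdir : DirectedOn (· ≤ ·) c := hc.directedOn
      refine ⟨LinearPMap.sSup c hdir, ⟨(hcs hg₀).1.trans (LinearPMap.le_sSup hdir hg₀), ?_⟩,
        fun g hg => LinearPMap.le_sSup hdir hg⟩
      rw [equationallyFlat_quotient_iff]
      intro n r p hp
      obtain ⟨g, hg, hgp⟩ := (LinearPMap.mem_domain_sSup_iff ⟨g₀, hg₀⟩ hdir).1 hp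
      obtain ⟨k, a, p', hp', ha⟩ := (equationallyFlat_quotient_iff _).1 (hcs hg).2 n r p hgp
      exact ⟨k, a, p', fun i => (LinearPMap.le_sSup hdir hg).1 (hp' i), ha⟩)
    f₀ ⟨le_rfl, hK⟩
  suffices htop : g.domain = ⊤ by
    let e : P →ₗ[Rᵐᵒᵖ] g.domain := LinearMap.id.codRestrict _ fun x => htop ▸ Submodule.mem_top
    exact ⟨g.toFun ∘ₗ e, fun x => (hf₀g.2 (x := x) (y := e x) rfl).symm⟩
  by_contra hne
  obtain ⟨x, hx⟩ : ∃ x, x ∉ g.domain := by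
    by_contra! hall
    exact hne (Submodule.eq_top_iff'.2 hall)
  obtain ⟨G, hxG, hGc, hGflat, hGpure⟩ := hgflat.exists_countable_pure (g.domain.mkQ x)
  let N := G.comap g.domain.mkQ
  have hle : g.domain ≤ N := fun y hy => by
    change g.domain.mkQ y ∈ G
    rw [show g.domain.mkQ y = 0 from (Submodule.Quotient.mk_eq_zero _).2 hy]
    exact G.zero_mem
  let π : N →ₗ[Rᵐᵒᵖ] G := g.domain.mkQ.restrict fun y hy => hy
  have hπ : Function.Surjective π := fun ⟨y, hy⟩ => by
    obtain ⟨z, rfl⟩ := g.domain.mkQ_surjective y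
    exact ⟨⟨z, hy⟩, rfl⟩
  have hker : ∀ y : N, y ∈ LinearMap.ker π ↔ (y : P) ∈ g.domain := fun y => by
    rw [← Submodule.Quotient.mk_eq_zero g.domain, LinearMap.mem_ker, Subtype.ext_iff]
    rfl
  let i : LinearMap.ker π →ₗ[Rᵐᵒᵖ] g.domain :=
    (N.subtype ∘ₗ (LinearMap.ker π).subtype).codRestrict _ fun y => (hker y).1 y.2
  obtain ⟨h, hh⟩ := hC G hGc hGflat N π hπ (g.toFun ∘ₗ i)
  have hgh : g ≤ ⟨N, h⟩ := ⟨hle, fun y z hyz => by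
    have hz : z ∈ LinearMap.ker π := (hker z).2 (hyz ▸ y.2)
    have := hh ⟨z, hz⟩
    rw [LinearMap.comp_apply, show i ⟨z, hz⟩ = y from Subtype.ext hyz.symm] at this
    exact this.symm⟩
  refine hx ((hmax ⟨hf₀g.trans hgh, ?_⟩ hgh).1 hxG)
  rw [equationallyFlat_quotient_iff]
  intro n r p hp
  obtain ⟨q, hqG, hq⟩ := hGpure n r (fun i => g.domain.mkQ (p i)) (by simpa [N] using hp)
  obtain ⟨k, a, m', hm', ha⟩ := hgflat n r (fun i => g.domain.mkQ (p i) - q i) (by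
    simp only [smul_sub, Finset.sum_sub_distrib, hq, sub_self])
  choose p' hp' using fun j => g.domain.mkQ_surjective (m' j)
  refine ⟨k, a, p', fun i => ?_, ha⟩
  change g.domain.mkQ _ ∈ G
  have : g.domain.mkQ (p i - ∑ j, op (a j i) • p' j) = q i := by
    rw [map_sub, map_sum]
    simp only [map_smul, hp', ← hm']
    abel
  rw [this]
  exact hqG i

end Extension

section ExtExtension
open CategoryTheory

theorem subsingleton_ext1_iff_of_projectiveResolution {R : Type u} [Ring R]
    {X : ModuleCat.{u} Rᵐᵒᵖ} (P : ProjectiveResolution X) (Y : ModuleCat.{u} Rᵐᵒᵖ) :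
    Subsingleton (ext1 R X Y) ↔
      ∀ g : P.complex.X 1 ⟶ Y, P.complex.d 2 1 ≫ g = 0 →
        ∃ h : P.complex.X 0 ⟶ Y, P.complex.d 1 0 ≫ h = g := by
  rw [← ModuleCat.isZero_iff_subsingleton, ext1, (P.isoExt 1 Y).isZero_iff,
    ← HomologicalComplex.exactAt_iff_isZero_homology,
    HomologicalComplex.exactAt_iff' _ 0 1 2 (by simp) (by simp), ShortComplex.moduleCat_exact_iff]
  rfl

theorem LinearMap.exists_comp_eq_of_surjective_of_ker_le {S M N Y : Type*} [Ring S]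
    [AddCommGroup M] [AddCommGroup N] [AddCommGroup Y] [Module S M] [Module S N] [Module S Y]
    (φ : M →ₗ[S] N) (hφ : Function.Surjective φ) (ψ : M →ₗ[S] Y)
    (h : ∀ x, φ x = 0 → ψ x = 0) : ∃ e : N →ₗ[S] Y, ∀ x, e (φ x) = ψ x := by
  refine ⟨(LinearMap.ker φ).liftQ ψ (fun x hx => h x hx) ∘ₗ
    (φ.quotKerEquivOfSurjective hφ).symm.toLinearMap, fun x => ?_⟩
  have hx : (φ.quotKerEquivOfSurjective hφ).symm (φ x) = Submodule.Quotient.mk x := by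
    rw [LinearEquiv.symm_apply_eq]
    rfl
  simpa [hx] using Submodule.liftQ_apply _ _ _

theorem exists_extension_iff_of_exact {S P₂ P₁ P₀ X Y : Type u} [Ring S]
    [AddCommGroup P₂] [AddCommGroup P₁] [AddCommGroup P₀] [AddCommGroup X] [AddCommGroup Y]
    [Module S P₂] [Module S P₁] [Module S P₀] [Module S X] [Module S Y] [Module.Projective S P₀]
    (d₂ : P₂ →ₗ[S] P₁) (d₁ : P₁ →ₗ[S] P₀) (ε : P₀ →ₗ[S] X) (hε : Function.Surjective ε)
    (h₁ : Function.Exact d₂ d₁) (h₀ : Function.Exact d₁ ε) :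
    (∀ g : P₁ →ₗ[S] Y, (∀ x, g (d₂ x) = 0) → ∃ h : P₀ →ₗ[S] Y, ∀ x, h (d₁ x) = g x) ↔
      ∀ (B : Type u) [AddCommGroup B] [Module S B] (π : B →ₗ[S] X),
        Function.Surjective π → ∀ g : LinearMap.ker π →ₗ[S] Y,
          ∃ h : B →ₗ[S] Y, ∀ x : LinearMap.ker π, h x = g x := by
  constructor
  · intro H B _ _ π hπ g
    obtain ⟨l, hl⟩ := Module.projective_lifting_property π ε hπ
    replace hl : ∀ p, π (l p) = ε p := fun p => by rw [← hl]; rfl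
    let k : P₁ →ₗ[S] LinearMap.ker π := (l ∘ₗ d₁).codRestrict _ fun x => by
      simp [hl, h₀.apply_apply_eq_zero]
    have hk : ∀ x, (k x : B) = l (d₁ x) := fun x => rfl
    obtain ⟨e, he⟩ := H (g ∘ₗ k) fun x => by
      have : k (d₂ x) = 0 := Subtype.ext (by simp [hk, h₁.apply_apply_eq_zero])
      simp [this]
    obtain ⟨h, hh⟩ := LinearMap.exists_comp_eq_of_surjective_of_ker_le
      ((LinearMap.ker π).subtype.coprod l) (fun b => by
        obtain ⟨p, hp⟩ := hε (π b)
        exact ⟨(⟨b - l p, by simp [hl, hp]⟩, p), by simp⟩) (g.coprod e) (by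
        rintro ⟨a, p⟩ hap
        simp only [LinearMap.coprod_apply, Submodule.subtype_apply] at hap ⊢
        have hp : ε p = 0 := by
          have := congrArg π hap
          rwa [map_add, hl, a.2, zero_add, map_zero] at this
        obtain ⟨q, rfl⟩ := (h₀ p).1 hp
        have ha : a = -k q := Subtype.ext (by simpa [hk] using eq_neg_of_add_eq_zero_left hap)
        rw [he, ha]
        simp)
    exact ⟨h, fun x => by simpa using hh (x, 0)⟩
  · intro H g hg
    let k : P₁ →ₗ[S] LinearMap.ker ε := d₁.codRestrict _ fun x => h₀.apply_apply_eq_zero x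
    have hk : ∀ x, (k x : P₀) = d₁ x := fun x => rfl
    obtain ⟨g', hg'⟩ := LinearMap.exists_comp_eq_of_surjective_of_ker_le k (fun a => by
      obtain ⟨q, hq⟩ := (h₀ a).1 a.2
      exact ⟨q, Subtype.ext hq⟩) g (fun x hx => by
        obtain ⟨y, rfl⟩ := (h₁ x).1 (by rw [← hk, hx]; rfl)
        exact hg y)
    obtain ⟨h, hh⟩ := H P₀ ε hε g'
    exact ⟨h, fun x => by rw [← hk, hh, hg']⟩

theorem subsingleton_ext1_iff {R : Type u} [Ring R] (X Y : ModuleCat.{u} Rᵐᵒᵖ) :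
    Subsingleton (ext1 R X Y) ↔
      ∀ (B : Type u) [AddCommGroup B] [Module Rᵐᵒᵖ B] (π : B →ₗ[Rᵐᵒᵖ] X),
        Function.Surjective π → ∀ g : LinearMap.ker π →ₗ[Rᵐᵒᵖ] Y,
          ∃ h : B →ₗ[Rᵐᵒᵖ] Y, ∀ x : LinearMap.ker π, h x = g x := by
  obtain ⟨⟨P⟩⟩ : HasProjectiveResolution X := inferInstance
  have hproj : Module.Projective Rᵐᵒᵖ (P.complex.X 0) :=
    (IsProjective.iff_projective _).2 (P.projective 0)
  have hπ : Function.Surjective (P.π.f 0).hom := (ModuleCat.epi_iff_surjective _).1 inferInstance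
  have h₀ : Function.Exact (P.complex.d 1 0).hom (P.π.f 0).hom :=
    (ShortComplex.ShortExact.moduleCat_exact_iff_function_exact _).1 P.exact₀
  have h₁ : Function.Exact (P.complex.d 2 1).hom (P.complex.d 1 0).hom :=
    (ShortComplex.ShortExact.moduleCat_exact_iff_function_exact _).1 (P.exact_succ 0)
  rw [subsingleton_ext1_iff_of_projectiveResolution P]
  refine Iff.trans ?_ (exists_extension_iff_of_exact (X := X) (Y := Y) (P.complex.d 2 1).hom
    (P.complex.d 1 0).hom (P.π.f 0).hom hπ h₁ h₀)
  constructor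
  · intro H g hg
    obtain ⟨h, hh⟩ := H (ModuleCat.ofHom g) (by ext x; exact hg x)
    exact ⟨h.hom, fun x => congrArg (fun f => f.hom x) hh⟩
  · intro H g hg
    obtain ⟨h, hh⟩ := H g.hom (fun x => congrArg (fun f => f.hom x) hg)
    exact ⟨ModuleCat.ofHom h, by ext x; exact hh x⟩

end ExtExtension

/-- Over a countable ring `R`, if a right `R`-module `C` is not
cotorsion then there is a countable flat right `R`-module `F` with `Ext¹(F, C) ≠ 0`;
equivalently, `C` is cotorsion iff `Ext¹(F, C) = 0` for every countable flat module
`F`. -/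
theorem exists_countable_flat_ext_ne_zero_of_not_cotorsion
    (R : Type u) [Ring R] [Countable R] (C : ModuleCat.{u} Rᵐᵒᵖ) :
    ((¬ ∀ F : ModuleCat.{u} Rᵐᵒᵖ, IsRightFlat R F → Subsingleton (ext1 R F C)) →
        ∃ F : ModuleCat.{u} Rᵐᵒᵖ, Countable F ∧ IsRightFlat R F ∧
          ¬ Subsingleton (ext1 R F C)) ∧
      ((∀ F : ModuleCat.{u} Rᵐᵒᵖ, IsRightFlat R F → Subsingleton (ext1 R F C)) ↔
        ∀ F : ModuleCat.{u} Rᵐᵒᵖ, Countable F → IsRightFlat R F →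
          Subsingleton (ext1 R F C)) := by
  have key : (∀ F : ModuleCat.{u} Rᵐᵒᵖ, Countable F → IsRightFlat R F →
      Subsingleton (ext1 R F C)) →
        ∀ F : ModuleCat.{u} Rᵐᵒᵖ, IsRightFlat R F → Subsingleton (ext1 R F C) := by
    intro H F hF
    rw [subsingleton_ext1_iff]
    intro B _ _ π hπ g
    refine exists_extension_of_equationallyFlat_quotient (fun G _ _ hGc hG =>
      (subsingleton_ext1_iff (ModuleCat.of Rᵐᵒᵖ G) C).1 (H _ hGc hG.isRightFlat))
      (LinearMap.ker π) ?_ g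
    rw [equationallyFlat_quotient_iff]
    intro n r p hp
    obtain ⟨k, a, m, hm, ha⟩ := hF.equationallyFlat n r (fun i => π (p i)) (by simpa using hp)
    choose p' hp' using fun j => hπ (m j)
    exact ⟨k, a, p', fun i => by simp [hm, hp'], ha⟩
  refine ⟨fun hC => ?_, fun H F _ hF => H F hF, key⟩
  by_contra! H
  exact hC (key H)
end
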